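/- Let R be a commutative ring, n ≥ m ≥ 1, and f, g ∈ R[t] with deg f ≤ n, deg g ≤ m, leading coefficients aₙ, bₘ (coefficients of tⁿ and tᵐ respectively). Suppose there exists a non zero-divisor d ∈ R with ideal ⟨aₙ, bₘ⟩ = ⟨d⟩. For 0 ≤ j ≤ m, let ψⱼ : Rʲ ⊕ R[t]_{≤m−j−1} ⊕ R[t]_{≤n−j−1} → R[t]_{≤m+n−j−1} be the map (eᵢ, a(t), b(t)) ↦ p_{m−j+i−1}(t) + a(t)f(t) + b(t)g(t), where pₖ = gₖf − fₖg as above. Then for each j = 0, …, m−1, there is an exact sequence of R-modules R/⟨d⟩ → coker(ψ_{j+1}) → coker(ψⱼ) → R/⟨d⟩ → 0. -/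

import Mathlib

open Polynomial

/-- The polynomial `pₖ = gₖ·f − fₖ·g`, where `fₖ` and `gₖ` are the top parts of `f` and `g`
(of respective degrees at most `n` and `m`). -/
noncomputable def hybridP {R : Type*} [CommRing R] (f g : R[X]) (n m k : ℕ) : R[X] :=
  (∑ j ∈ Finset.range (k + 1), C (g.coeff (m - k + j)) * X ^ j) * f -
    (∑ j ∈ Finset.range (n - m + k + 1), C (f.coeff (m - k + j)) * X ^ j) * g

/-- An abstract version of the exact sequence. -/
theorem hybrid_core {R : Type*} [CommRing R] (k l M j k' l' M' : ℕ)
    (hk : k' = k + 1) (hl : l' = l + 1) (hM : M' = M + 1)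
    (f g : R[X]) (p : ℕ → R[X]) (a b d : R) (hd : d ∈ nonZeroDivisors R)
    (hgen : Ideal.span {a, b} = Ideal.span {d})
    (G F : R[X]) (hp0 : p 0 = G * f - F * g)
    (hG : G ∈ degreeLT R (k + 1)) (hF : F ∈ degreeLT R (l + 1))
    (hGb : G.coeff k = b) (hFa : F.coeff l = a)
    (hf : ∀ A ∈ degreeLT R (k + 1), (A * f).coeff M = A.coeff k * a)
    (hg : ∀ B ∈ degreeLT R (l + 1), (B * g).coeff M = B.coeff l * b)
    (ψj : ((Fin j → R) × (↥(degreeLT R k') × ↥(degreeLT R l'))) →ₗ[R] ↥(degreeLT R M'))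
    (hψj : ∀ x, ((ψj x : R[X])) = (∑ i : Fin j, x.1 i • p (i + 1)) +
          (x.2.1 : R[X]) * f + (x.2.2 : R[X]) * g)
    (ψj1 : ((Fin (j + 1) → R) × (↥(degreeLT R k) × ↥(degreeLT R l))) →ₗ[R] ↥(degreeLT R M))
    (hψj1 : ∀ x, ((ψj1 x : R[X])) = (∑ i : Fin (j + 1), x.1 i • p i) +
          (x.2.1 : R[X]) * f + (x.2.2 : R[X]) * g) :
    ∃ (α : (R ⧸ Ideal.span {d}) →ₗ[R] (↥(degreeLT R M) ⧸ LinearMap.range ψj1))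
      (β : (↥(degreeLT R M) ⧸ LinearMap.range ψj1) →ₗ[R]
        (↥(degreeLT R M') ⧸ LinearMap.range ψj))
      (γ : (↥(degreeLT R M') ⧸ LinearMap.range ψj) →ₗ[R] R ⧸ Ideal.span {d}),
      Function.Exact ⇑α ⇑β ∧ Function.Exact ⇑β ⇑γ ∧ Function.Surjective ⇑γ := by
  subst hk hl hM
  have topz : ∀ q ∈ degreeLT R M, q.coeff M = 0 := fun q hq =>
    coeff_eq_zero_of_degree_lt (mem_degreeLT.1 hq)
  have low : ∀ (N : ℕ) (q : R[X]), q ∈ degreeLT R (N + 1) → q.coeff N = 0 →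
      q ∈ degreeLT R N := by
    intro N q hq h0
    rw [mem_degreeLT, degree_lt_iff_coeff_zero] at hq ⊢
    intro i hi
    rcases Nat.eq_or_lt_of_le hi with h | h
    · rw [← h, h0]
    · exact hq i h
  have mono : ∀ N : ℕ, degreeLT R N ≤ degreeLT R (N + 1) := fun N =>
    degreeLT_mono (Nat.le_succ N)
  have monom : ∀ (N : ℕ) (c : R), C c * X ^ N ∈ degreeLT R (N + 1) := by
    intro N c
    rw [mem_degreeLT]
    exact lt_of_le_of_lt (degree_C_mul_X_pow_le N c) (by exact_mod_cast Nat.lt_succ_self N)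
  have hpM : ∀ i : Fin (j + 1), p i ∈ degreeLT R M := by
    intro i
    have h := hψj1 (Pi.single i 1, 0, 0)
    simp [Pi.single_apply] at h
    rw [← h]; exact (ψj1 _).2
  have sumtop : ∀ c : Fin j → R, (∑ i : Fin j, c i • p (i + 1)).coeff M = 0 := by
    intro c
    apply topz
    exact Submodule.sum_mem _ fun i _ => Submodule.smul_mem _ _ (hpM i.succ)
  have ψtop : ∀ x, (ψj x : R[X]).coeff M =
      (x.2.1 : R[X]).coeff k * a + (x.2.2 : R[X]).coeff l * b := by
    intro x
    rw [hψj, coeff_add, coeff_add, sumtop, hf _ x.2.1.2, hg _ x.2.2.2, zero_add]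
  -- Bezout data
  obtain ⟨u, hu⟩ : ∃ u, a = d * u := by
    have : a ∈ Ideal.span {d} := hgen ▸ Ideal.subset_span (by simp)
    exact Ideal.mem_span_singleton.1 this
  obtain ⟨v, hv⟩ : ∃ v, b = d * v := by
    have : b ∈ Ideal.span {d} := hgen ▸ Ideal.subset_span (by simp)
    exact Ideal.mem_span_singleton.1 this
  obtain ⟨r, s, hrs⟩ : ∃ r s, r * a + s * b = d := by
    have : d ∈ Ideal.span {a, b} := hgen ▸ Ideal.subset_span (by simp)
    exact Ideal.mem_span_pair.1 this
  have cancel : ∀ x : R, d * x = 0 → x = 0 := fun x hx => by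
    rw [mul_comm] at hx
    exact (mul_right_mem_nonZeroDivisors_eq_zero_iff hd).1 hx
  have huv : r * u + s * v = 1 := by
    have : r * u + s * v - 1 = 0 := cancel _ (by rw [hu, hv] at hrs; linear_combination hrs)
    linear_combination this
  -- membership characterizations
  have memj : ∀ (c : Fin j → R) (A B : R[X]), A ∈ degreeLT R (k + 1) → B ∈ degreeLT R (l + 1) →
      ∀ y : degreeLT R (M + 1), (y : R[X]) = (∑ i : Fin j, c i • p (i + 1)) + A * f + B * g →
      y ∈ LinearMap.range ψj := by
    intro c A B hA hB y hy
    refine ⟨(c, ⟨A, hA⟩, ⟨B, hB⟩), Subtype.ext ?_⟩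
    rw [hψj, hy]
  have memj1 : ∀ (c0 : R) (c : Fin j → R) (A B : R[X]), A ∈ degreeLT R k → B ∈ degreeLT R l →
      ∀ y : degreeLT R M, (y : R[X]) =
        c0 • p 0 + (∑ i : Fin j, c i • p (i + 1)) + A * f + B * g →
      y ∈ LinearMap.range ψj1 := by
    intro c0 c A B hA hB y hy
    refine ⟨(Fin.cons c0 c, ⟨A, hA⟩, ⟨B, hB⟩), Subtype.ext ?_⟩
    rw [hψj1, hy, Fin.sum_univ_succ]
    simp
  obtain ⟨ι, hι⟩ : ∃ ι : degreeLT R M →ₗ[R] degreeLT R (M + 1),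
      ∀ y, ((ι y : degreeLT R (M + 1)) : R[X]) = y :=
    ⟨Submodule.inclusion (mono M), Submodule.coe_inclusion (mono M)⟩
  have hβ : LinearMap.range ψj1 ≤ (LinearMap.range ψj).comap ι := by
    rintro _ ⟨x, rfl⟩
    rw [Submodule.mem_comap]
    refine memj (fun i => x.1 i.succ) (x.1 0 • G + x.2.1) (-(x.1 0 • F) + x.2.2)
      (Submodule.add_mem _ (Submodule.smul_mem _ _ hG) (mono k x.2.1.2))
      (Submodule.add_mem _ (Submodule.neg_mem _ (Submodule.smul_mem _ _ hF)) (mono l x.2.2.2)) _ ?_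
    rw [hι, hψj1, Fin.sum_univ_succ]
    simp only [Fin.val_zero, Fin.val_succ, hp0, smul_eq_C_mul]
    ring
  obtain ⟨W, hW⟩ : ∃ W : R[X], W = (C v * X ^ k) * f - (C u * X ^ l) * g := ⟨_, rfl⟩
  obtain ⟨τ, hτ⟩ : ∃ τ : degreeLT R (M + 1) →ₗ[R] R, ∀ y, τ y = (y : R[X]).coeff M :=
    ⟨(lcoeff R M).comp (degreeLT R (M + 1)).subtype, fun y => by
      rw [LinearMap.comp_apply, Submodule.subtype_apply, lcoeff_apply]⟩
  have hγ : LinearMap.range ψj ≤ Submodule.comap τ (Ideal.span {d}) := by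
    rintro _ ⟨x, rfl⟩
    rw [Submodule.mem_comap, hτ, ψtop, hu, hv]
    exact Ideal.mem_span_singleton.2 ⟨(x.2.1 : R[X]).coeff k * u + (x.2.2 : R[X]).coeff l * v,
      by ring⟩
  have hWf : W ∈ degreeLT R M := by
    apply low
    · have h := hψj (0, ⟨C v * X ^ k, monom k v⟩, ⟨-(C u * X ^ l), Submodule.neg_mem _ (monom l u)⟩)
      have h2 : W = (ψj (0, ⟨C v * X ^ k, monom k v⟩,
          ⟨-(C u * X ^ l), Submodule.neg_mem _ (monom l u)⟩) : R[X]) := by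
        rw [h]; simp [hW]; ring
      rw [h2]; exact (ψj _).2
    · rw [hW, coeff_sub, hf _ (monom k v), hg _ (monom l u), coeff_C_mul_X_pow, coeff_C_mul_X_pow,
        if_pos rfl, if_pos rfl, hu, hv]
      ring
  obtain ⟨w, hw⟩ : ∃ w : degreeLT R M, (w : R[X]) = (C v * X ^ k) * f - (C u * X ^ l) * g :=
    ⟨⟨W, hWf⟩, hW⟩
  have hα : Ideal.span {d} ≤
      LinearMap.ker (LinearMap.toSpanSingleton R _ ((LinearMap.range ψj1).mkQ w)) := by
    rw [Ideal.span_le, Set.singleton_subset_iff]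
    rw [SetLike.mem_coe, LinearMap.mem_ker, LinearMap.toSpanSingleton_apply, ← map_smul, Submodule.mkQ_apply,
      Submodule.Quotient.mk_eq_zero]
    refine memj1 1 0 (C b * X ^ k - G) (F - C a * X ^ l) ?_ ?_ _ ?_
    · apply low _ _ (Submodule.sub_mem _ (monom k b) hG)
      simp [hGb]
    · apply low _ _ (Submodule.sub_mem _ hF (monom l a))
      simp [hFa]
    · rw [Submodule.coe_smul, hw]
      simp only [hp0, smul_eq_C_mul, hu, hv, C_mul, Pi.zero_apply, C_0, C_1, zero_mul,
        Finset.sum_const_zero]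
      ring
  refine ⟨Submodule.liftQ _ _ hα, Submodule.mapQ _ _ ι hβ, Submodule.mapQ _ _ τ hγ, ?_, ?_, ?_⟩
  · intro y
    obtain ⟨y, rfl⟩ := Submodule.Quotient.mk_surjective _ y
    rw [Submodule.mapQ_apply, Submodule.Quotient.mk_eq_zero]
    constructor
    · rintro ⟨x, hx⟩
      have hxv := hψj x
      have h0 := ψtop x
      rw [hx, hι] at hxv h0
      rw [topz _ y.2] at h0
      set A : R[X] := (x.2.1 : R[X]) with hA
      set B : R[X] := (x.2.2 : R[X]) with hB
      have h1 : A.coeff k * u + B.coeff l * v = 0 := cancel _ (by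
        rw [hu, hv] at h0; linear_combination -h0)
      obtain ⟨c, hc⟩ : ∃ c : R, c = s * A.coeff k - r * B.coeff l := ⟨_, rfl⟩
      have hcv : A.coeff k = c * v := by
        rw [hc]; linear_combination -(A.coeff k) * huv + r * h1
      have hcu : B.coeff l = -(c * u) := by
        rw [hc]; linear_combination -(B.coeff l) * huv + s * h1
      refine ⟨Submodule.Quotient.mk c, ?_⟩
      rw [Submodule.liftQ_apply, LinearMap.toSpanSingleton_apply, ← map_smul, Submodule.mkQ_apply,
        eq_comm, Submodule.Quotient.eq]
      refine memj1 0 x.1 (A - C (c * v) * X ^ k) (B + C (c * u) * X ^ l) ?_ ?_ _ ?_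
      · apply low _ _ (Submodule.sub_mem _ x.2.1.2 (monom k _))
        rw [coeff_sub, coeff_C_mul_X_pow, if_pos rfl, ← hcv, sub_self]
      · apply low _ _ (Submodule.add_mem _ x.2.2.2 (monom l _))
        rw [coeff_add, coeff_C_mul_X_pow, if_pos rfl]
        linear_combination hcu
      · rw [Submodule.coe_sub, Submodule.coe_smul, hw, hxv]
        simp only [smul_eq_C_mul, C_mul, C_0, zero_mul]
        ring
    · rintro ⟨c, hc⟩
      obtain ⟨c, rfl⟩ := Submodule.Quotient.mk_surjective _ c
      rw [Submodule.liftQ_apply, LinearMap.toSpanSingleton_apply, ← map_smul, Submodule.mkQ_apply,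
        eq_comm, Submodule.Quotient.eq] at hc
      have h1 := hβ hc
      rw [Submodule.mem_comap, map_sub] at h1
      have h2 : ι (c • w) ∈ LinearMap.range ψj := by
        refine memj 0 (C (c * v) * X ^ k) (-(C (c * u) * X ^ l)) (monom _ _)
          (Submodule.neg_mem _ (monom _ _)) _ ?_
        rw [hι, Submodule.coe_smul, hw]
        simp only [smul_eq_C_mul, C_mul, C_0, zero_mul, Pi.zero_apply, Finset.sum_const_zero]
        ring
      simpa using Submodule.add_mem _ h1 h2
  · intro y
    obtain ⟨y, rfl⟩ := Submodule.Quotient.mk_surjective _ y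
    rw [Submodule.mapQ_apply, Submodule.Quotient.mk_eq_zero]
    constructor
    · intro h
      obtain ⟨e, he⟩ := Ideal.mem_span_singleton.1 h
      rw [hτ] at he
      let x : (Fin j → R) × (↥(degreeLT R (k + 1)) × ↥(degreeLT R (l + 1))) :=
        (0, ⟨C (e * r) * X ^ k, monom _ _⟩, ⟨C (e * s) * X ^ l, monom _ _⟩)
      have hz : (y - ψj x : degreeLT R (M + 1)).1 ∈ degreeLT R M := by
        apply low _ _ (y - ψj x).2
        rw [Submodule.coe_sub, coeff_sub, ψtop, he]
        simp only [x, coeff_C_mul_X_pow, if_true]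
        linear_combination -e * hrs
      refine ⟨Submodule.Quotient.mk ⟨_, hz⟩, ?_⟩
      rw [Submodule.mapQ_apply, Submodule.Quotient.eq]
      refine ⟨-x, ?_⟩
      rw [map_neg]
      apply Subtype.ext
      rw [Submodule.coe_sub, hι]
      simp
    · rintro ⟨z, hz⟩
      obtain ⟨z, rfl⟩ := Submodule.Quotient.mk_surjective _ z
      rw [Submodule.mapQ_apply, Submodule.Quotient.eq] at hz
      have h1 := hγ hz
      rw [Submodule.mem_comap, map_sub, hτ, hι, topz _ z.2, zero_sub] at h1
      simpa using Submodule.neg_mem _ h1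
  · intro y
    obtain ⟨y, rfl⟩ := Submodule.Quotient.mk_surjective _ y
    refine ⟨Submodule.Quotient.mk ⟨C y * X ^ M, monom _ _⟩, ?_⟩
    rw [Submodule.mapQ_apply, hτ]
    simp

theorem hybrid_top {R : Type*} [CommRing R] (k n : ℕ) (f A : R[X]) (hf : f.natDegree ≤ n)
    (hA : A ∈ degreeLT R (k + 1)) : (A * f).coeff (k + n) = A.coeff k * f.coeff n := by
  apply coeff_mul_add_eq_of_natDegree_le _ hf
  rw [natDegree_le_iff_degree_le]
  rw [mem_degreeLT] at hA
  exact Order.le_of_lt_succ hA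

theorem hybrid_sum_mem {R : Type*} [CommRing R] (k : ℕ) (c : ℕ → R) :
    (∑ i ∈ Finset.range (k + 1), C (c i) * X ^ i) ∈ degreeLT R (k + 1) := by
  refine Submodule.sum_mem _ fun i hi => ?_
  rw [mem_degreeLT]
  exact lt_of_le_of_lt (degree_C_mul_X_pow_le i _) (by exact_mod_cast Finset.mem_range.1 hi)

theorem hybrid_sum_coeff {R : Type*} [CommRing R] (k : ℕ) (c : ℕ → R) :
    (∑ i ∈ Finset.range (k + 1), C (c i) * X ^ i).coeff k = c k := by
  simp [coeff_C_mul, coeff_X_pow]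

/-- If the ideal generated by the top coefficients `aₙ` of `f` and `bₘ` of `g` is generated by
a non zero-divisor `d`, then for each `j = 0, …, m − 1` there is an exact sequence
`R/(d) → coker ψ_(j+1) → coker ψⱼ → R/(d) → 0`, where
`ψⱼ : Rʲ ⊕ R[t]_{≤ m−j−1} ⊕ R[t]_{≤ n−j−1} → R[t]_{≤ m+n−j−1}` sends
`(eᵢ, a, b) ↦ p_(m−j+i−1) + a f + b g`.  (Note `R[t]_{≤ k} = degreeLT R (k+1)`.) -/
theorem exact_seq_coker_hybrid_maps
    (R : Type*) [CommRing R] (n m : ℕ) (hm : 1 ≤ m) (hmn : m ≤ n)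
    (f g : R[X]) (hf : f.natDegree ≤ n) (hg : g.natDegree ≤ m)
    (d : R) (hd : d ∈ nonZeroDivisors R)
    (hgen : Ideal.span {f.coeff n, g.coeff m} = Ideal.span {d})
    (j : ℕ) (hj : j ≤ m - 1)
    (ψj : ((Fin j → R) × (↥(degreeLT R (m - j)) × ↥(degreeLT R (n - j)))) →ₗ[R]
      ↥(degreeLT R (m + n - j)))
    (hψj : ∀ x : (Fin j → R) × (↥(degreeLT R (m - j)) × ↥(degreeLT R (n - j))),
      ((ψj x : R[X])) =
        (∑ i : Fin j, x.1 i • hybridP f g n m (m - j + (i : ℕ))) +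
          (x.2.1 : R[X]) * f + (x.2.2 : R[X]) * g)
    (ψj1 : ((Fin (j + 1) → R) ×
        (↥(degreeLT R (m - (j + 1))) × ↥(degreeLT R (n - (j + 1))))) →ₗ[R]
      ↥(degreeLT R (m + n - (j + 1))))
    (hψj1 : ∀ x : (Fin (j + 1) → R) ×
        (↥(degreeLT R (m - (j + 1))) × ↥(degreeLT R (n - (j + 1)))),
      ((ψj1 x : R[X])) =
        (∑ i : Fin (j + 1), x.1 i • hybridP f g n m (m - (j + 1) + (i : ℕ))) +
          (x.2.1 : R[X]) * f + (x.2.2 : R[X]) * g) :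
    ∃ (α : (R ⧸ Ideal.span {d}) →ₗ[R]
        (↥(degreeLT R (m + n - (j + 1))) ⧸ LinearMap.range ψj1))
      (β : (↥(degreeLT R (m + n - (j + 1))) ⧸ LinearMap.range ψj1) →ₗ[R]
        (↥(degreeLT R (m + n - j)) ⧸ LinearMap.range ψj))
      (γ : (↥(degreeLT R (m + n - j)) ⧸ LinearMap.range ψj) →ₗ[R] R ⧸ Ideal.span {d}),
      Function.Exact ⇑α ⇑β ∧ Function.Exact ⇑β ⇑γ ∧ Function.Surjective ⇑γ := by
  have e1 : n - m + (m - (j + 1)) = n - (j + 1) := by omega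
  refine hybrid_core (m - (j + 1)) (n - (j + 1)) (m + n - (j + 1)) j (m - j) (n - j) (m + n - j)
    (by omega) (by omega) (by omega) f g (fun i => hybridP f g n m (m - (j + 1) + i))
    (f.coeff n) (g.coeff m) d hd hgen
    (∑ i ∈ Finset.range (m - (j + 1) + 1), C (g.coeff (m - (m - (j + 1)) + i)) * X ^ i)
    (∑ i ∈ Finset.range (n - (j + 1) + 1), C (f.coeff (m - (m - (j + 1)) + i)) * X ^ i)
    ?_ (hybrid_sum_mem _ _) (hybrid_sum_mem _ _) ?_ ?_ ?_ ?_ ψj ?_ ψj1 hψj1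
  · simp only [hybridP, add_zero, e1]
  · rw [hybrid_sum_coeff _ (fun i => g.coeff (m - (m - (j + 1)) + i))]
    congr 1; omega
  · rw [hybrid_sum_coeff _ (fun i => f.coeff (m - (m - (j + 1)) + i))]
    congr 1; omega
  · intro A hA
    rw [← hybrid_top _ _ f A hf hA]
    congr 1; omega
  · intro B hB
    rw [← hybrid_top _ _ g B hg hB]
    congr 1; omega
  · intro x
    rw [hψj]
    have h : ∀ i : Fin j, m - (j + 1) + ((i : ℕ) + 1) = m - j + (i : ℕ) := fun i => by omega
    simp only [h]
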